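/- arXiv:math/0701836 — 2 statements merged into one kernel-verified Lean document; each statement's English description precedes it below -/
import Mathlib

section
/- Let γ ∈ PGL_{N+1}(𝔽_q) act on ℙ^N(k̄). Then for every integer m ≥ 1, the number of orbits O of the cyclic group ⟨γ⟩ on ℙ^N(k̄) with σ^m(O) = O equals 1 + q^m + q^{2m} + ⋯ + q^{Nm} = (q^{m(N+1)} − 1)/(q^m − 1). Equivalently, the quotient variety ℙ^N/⟨γ⟩ has the same zeta function over 𝔽_q as ℙ^N. -/
/-- The `q`-power Frobenius acting on `ℙ^{m-1}(k̄)` (raising homogeneous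
coordinates to the `q`-th power), where `q = |k|`. -/
noncomputable def projFrob (k : Type*) [Field k] [Fintype k] (m : ℕ) :
    Projectivization (AlgebraicClosure k) (Fin m → AlgebraicClosure k) →
    Projectivization (AlgebraicClosure k) (Fin m → AlgebraicClosure k) :=
  fun P => Projectivization.mk (AlgebraicClosure k)
    (fun i => (P.rep i) ^ (Fintype.card k)) (by
      intro h
      apply P.rep_nonzero
      funext i
      have hi : P.rep i ^ (Fintype.card k) = 0 := by simpa using congrFun h i
      simpa using pow_eq_zero_iff (Fintype.card_ne_zero (α := k)) |>.mp hi)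

/-- The projective automorphism of `ℙ^{m-1}(k̄)` induced by
`g ∈ GL_m(𝔽_q)`. -/
noncomputable def projGamma (k : Type*) [Field k] [Fintype k] (m : ℕ)
    (g : Matrix.GeneralLinearGroup (Fin m) k) :
    Projectivization (AlgebraicClosure k) (Fin m → AlgebraicClosure k) →
    Projectivization (AlgebraicClosure k) (Fin m → AlgebraicClosure k) :=
  fun P => Projectivization.mk (AlgebraicClosure k)
    (((g : Matrix (Fin m) (Fin m) k).map
        (algebraMap k (AlgebraicClosure k))).mulVec P.rep) (by
      intro h
      apply P.rep_nonzero
      set f := algebraMap k (AlgebraicClosure k)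
      have hBA : ((g⁻¹ : Matrix.GeneralLinearGroup (Fin m) k) : Matrix (Fin m) (Fin m) k).map f *
          ((g : Matrix (Fin m) (Fin m) k)).map f = 1 := by
        rw [← Matrix.map_mul]
        norm_cast
        rw [inv_mul_cancel g]
        exact Matrix.map_one f f.map_zero f.map_one
      calc P.rep = (1 : Matrix (Fin m) (Fin m) (AlgebraicClosure k)).mulVec P.rep := by
            rw [Matrix.one_mulVec]
        _ = _ := by rw [← hBA, ← Matrix.mulVec_mulVec, h, Matrix.mulVec_zero])

/-- The orbit of a projective point `P` under the cyclic group generated by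
the projective automorphism induced by `g ∈ GL_m(𝔽_q)`. -/
noncomputable def projOrbit (k : Type*) [Field k] [Fintype k] (m : ℕ)
    (g : Matrix.GeneralLinearGroup (Fin m) k)
    (P : Projectivization (AlgebraicClosure k) (Fin m → AlgebraicClosure k)) :
    Set (Projectivization (AlgebraicClosure k) (Fin m → AlgebraicClosure k)) :=
  {Q | ∃ i : ℤ, Q = projGamma k m (g ^ i) P}


theorem mem_range_of_pow_card {L A : Type*} [Field L] [Fintype L] [Field A] (φ : L →+* A) (x : A)
    (hx : x ^ Fintype.card L = x) : ∃ y, φ y = x := by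
  classical
  have h1 : (Polynomial.X ^ Fintype.card L - Polynomial.X : Polynomial L) =
      ∏ a : L, (Polynomial.X - Polynomial.C a) := by
    symm
    have := Polynomial.prod_multiset_X_sub_C_of_monic_of_roots_card_eq
      (p := (Polynomial.X ^ Fintype.card L - Polynomial.X : Polynomial L))
      (Polynomial.monic_X_pow_sub (by
        rw [Polynomial.degree_X]; exact_mod_cast Fintype.one_lt_card))
      (by rw [FiniteField.roots_X_pow_card_sub_X,
            FiniteField.X_pow_card_sub_X_natDegree_eq _ Fintype.one_lt_card]; rfl)
    rw [FiniteField.roots_X_pow_card_sub_X] at this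
    exact this
  have h2 := congrArg (Polynomial.eval₂ φ x) h1
  rw [Polynomial.eval₂_finsetProd] at h2
  simp only [Polynomial.eval₂_sub, Polynomial.eval₂_pow, Polynomial.eval₂_X, hx, sub_self,
    Polynomial.eval₂_C] at h2
  obtain ⟨a, -, ha⟩ := Finset.prod_eq_zero_iff.1 h2.symm
  exact ⟨a, (sub_eq_zero.1 ha).symm⟩

theorem twist_L {K L : Type*} [Field K] [Fintype K] [Field L] [Finite L] [Algebra K L]
    {n : ℕ} (g : Matrix.GeneralLinearGroup (Fin n) K) (hd : g ^ (Module.finrank K L) = 1) :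
    Nat.card {v : Fin n → L | (fun i => v i ^ Fintype.card K) =
      ((g : Matrix (Fin n) (Fin n) K).map (algebraMap K L)).mulVec v} = Fintype.card K ^ n := by
  classical
  set σ := FiniteField.frobeniusAlgEquivOfAlgebraic K L with hσ
  have hord : orderOf σ = Module.finrank K L := FiniteField.orderOf_frobeniusAlgEquivOfAlgebraic K L
  have hgen : ∀ τ : Gal(L/K), ∃ i : ℤ, σ ^ i = τ := fun τ => by
    obtain ⟨i, hi⟩ := (FiniteField.bijective_frobeniusAlgEquivOfAlgebraic_pow K L).2 τ
    exact ⟨(i.1 : ℤ), by simpa using hi⟩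
  have hcons : ∀ i j : ℤ, σ ^ i = σ ^ j → g ^ i = g ^ j := by
    intro i j hij
    rw [zpow_eq_zpow_iff_modEq, hord] at hij
    rw [zpow_eq_zpow_iff_modEq]
    exact hij.of_dvd (by exact_mod_cast orderOf_dvd_of_pow_eq_one hd)
  choose ix hix using hgen
  set b := IsGalois.normalBasis K L with hb
  have hbσ : ∀ τ, σ (b τ) = b (σ * τ) := fun τ => by
    rw [hb, IsGalois.normalBasis_apply, IsGalois.normalBasis_apply (σ * τ)]; rfl
  -- key equivalence
  have key : ∀ v : Fin n → L, ((fun i => v i ^ Fintype.card K) =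
      ((g : Matrix (Fin n) (Fin n) K).map (algebraMap K L)).mulVec v) ↔
      ∀ τ, (fun i => b.repr (v i) (σ⁻¹ * τ)) =
        (g : Matrix (Fin n) (Fin n) K).mulVec (fun i => b.repr (v i) τ) := by
    intro v
    have e1 : ∀ (x : L) τ, b.repr (x ^ Fintype.card K) τ = b.repr x (σ⁻¹ * τ) := by
      intro x τ
      have : x ^ Fintype.card K = σ x := rfl
      rw [this]
      conv_lhs => rw [← b.sum_repr x, map_sum]
      simp only [map_smul, hbσ]
      rw [← Equiv.sum_comp (Equiv.mulLeft σ⁻¹)]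
      simp [Finsupp.single_apply]
    have e2 : ∀ i τ, b.repr (((g : Matrix (Fin n) (Fin n) K).map (algebraMap K L)).mulVec v i) τ
        = (g : Matrix (Fin n) (Fin n) K).mulVec (fun i => b.repr (v i) τ) i := by
      intro i τ
      simp [Matrix.mulVec, dotProduct, ← Algebra.smul_def]
    constructor
    · intro h τ
      funext i
      rw [← e1, ← e2, ← h]
    · intro h
      funext i
      apply b.repr.injective
      ext τ
      rw [e1, e2, ← h]
  have iter : ∀ v : Fin n → L, (∀ τ, (fun i => b.repr (v i) (σ⁻¹ * τ)) =
        (g : Matrix (Fin n) (Fin n) K).mulVec (fun i => b.repr (v i) τ)) →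
      ∀ j : ℕ, (fun i => b.repr (v i) (σ⁻¹ ^ j)) =
        ((g ^ j : Matrix.GeneralLinearGroup (Fin n) K) : Matrix (Fin n) (Fin n) K).mulVec
          (fun i => b.repr (v i) 1) := by
    intro v h j
    induction j with
    | zero => simp
    | succ j ih =>
      rw [pow_succ', h, ih, pow_succ', Matrix.mulVec_mulVec]; rfl
  rw [show Fintype.card K ^ n = Nat.card (Fin n → K) by simp]
  refine Nat.card_eq_of_bijective (fun v => fun i => b.repr (v.1 i) 1) ⟨?_, ?_⟩
  · rintro ⟨v, hv⟩ ⟨w, hw⟩ h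
    rw [Set.mem_ofPred_eq, key] at hv hw
    have hv' := iter v hv
    have hw' := iter w hw
    simp only at h
    rw [← h] at hw'
    ext i
    apply b.repr.injective
    ext τ
    obtain ⟨j, hj⟩ : ∃ j : ℕ, σ⁻¹ ^ j = τ := by
      have : τ⁻¹ ∈ Submonoid.powers σ := by
        rw [mem_powers_iff_mem_zpowers]; exact ⟨_, hix _⟩
      obtain ⟨j, hj⟩ := this
      exact ⟨j, by rw [inv_pow, inv_eq_iff_eq_inv]; exact hj⟩
    have := congrFun ((hv' j).trans (hw' j).symm) i
    simpa [hj] using this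
  · intro u
    refine ⟨⟨fun i => ∑ τ, ((g ^ (- ix τ) : Matrix.GeneralLinearGroup (Fin n) K) :
      Matrix (Fin n) (Fin n) K).mulVec u i • b τ, ?_⟩, ?_⟩
    · rw [Set.mem_ofPred_eq, key]
      intro τ
      simp only [b.repr_sum_self]
      change Matrix.mulVec _ u = Matrix.mulVec _ (Matrix.mulVec _ u)
      rw [Matrix.mulVec_mulVec, ← Units.val_mul]
      congr 2
      rw [← zpow_one_add, add_comm]
      apply hcons
      rw [zpow_neg, hix, zpow_add_one, zpow_neg, hix]
      simp
    · funext i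
      simp only [b.repr_sum_self]
      have : g ^ (- ix 1) = 1 := by
        rw [← zpow_zero g]; apply hcons; rw [zpow_neg, hix]; simp
      simp [this]

theorem exists_ext (K : Type*) [Field K] [Fintype K] (d : ℕ) (hd : d ≠ 0) :
    ∃ (L : Type) (_ : Field L) (_ : Fintype L) (_ : Algebra K L),
      Fintype.card L = Fintype.card K ^ d ∧ Module.finrank K L = d := by
  obtain ⟨p, hp⟩ := CharP.exists K
  have : Fact p.Prime := ⟨CharP.char_is_prime K p⟩
  have : NeZero d := ⟨hd⟩
  refine ⟨FiniteField.Extension K p d, inferInstance, Fintype.ofFinite _, inferInstance, ?_, ?_⟩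
  · letI := Fintype.ofFinite (FiniteField.Extension K p d)
    rw [← Nat.card_eq_fintype_card, ← Nat.card_eq_fintype_card, FiniteField.natCard_extension]
  · exact FiniteField.finrank_extension K p d

theorem twist_A {K A : Type*} [Field K] [Fintype K] [Field A] [IsAlgClosed A] [Algebra K A]
    {n : ℕ} (g : Matrix.GeneralLinearGroup (Fin n) K) :
    Nat.card {v : Fin n → A | (fun i => v i ^ Fintype.card K) =
      ((g : Matrix (Fin n) (Fin n) K).map (algebraMap K A)).mulVec v} = Fintype.card K ^ n := by
  classical
  obtain ⟨L, _, _, _, hcard, hrank⟩ := exists_ext K (orderOf g) (orderOf_pos g).ne'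
  rw [← twist_L (L := L) g (by rw [hrank, pow_orderOf_eq_one])]
  let φ : L →ₐ[K] A := IsAlgClosed.lift
  have hφ : ∀ M : Matrix (Fin n) (Fin n) K, ∀ w : Fin n → L,
      (M.map (algebraMap K A)).mulVec (fun i => φ (w i)) =
      fun i => φ ((M.map (algebraMap K L)).mulVec w i) := by
    intro M w; funext i; simp [Matrix.mulVec, dotProduct]
  symm
  refine Nat.card_eq_of_bijective (fun w => ⟨fun i => φ (w.1 i), ?_⟩) ⟨?_, ?_⟩
  · have := w.2
    rw [Set.mem_ofPred_eq] at this ⊢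
    rw [hφ, ← this]; simp
  · intro v w h
    ext i
    exact φ.injective (congrFun (congrArg Subtype.val h) i)
  · rintro ⟨v, hv⟩
    rw [Set.mem_ofPred_eq] at hv
    have it : ∀ j : ℕ, (fun i => v i ^ Fintype.card K ^ j) =
        (((g ^ j : Matrix.GeneralLinearGroup (Fin n) K) : Matrix (Fin n) (Fin n) K).map
          (algebraMap K A)).mulVec v := by
      intro j
      induction j with
      | zero => simp
      | succ j ih =>
        funext i
        have h1 := congrFun ih i
        rw [pow_succ, pow_mul, h1, pow_succ, Units.val_mul, Matrix.map_mul,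
          ← Matrix.mulVec_mulVec, ← hv]
        simp only [Matrix.mulVec, dotProduct]
        have := map_sum (FiniteField.frobeniusAlgHom K A)
          (fun x => ((g ^ j : Matrix.GeneralLinearGroup (Fin n) K) : Matrix (Fin n) (Fin n) K).map
          (algebraMap K A) i x * v x) Finset.univ
        simp only [FiniteField.frobeniusAlgHom_apply] at this
        rw [this]
        simp [mul_pow, ← map_pow, FiniteField.pow_card]
    have hv' := it (orderOf g)
    rw [pow_orderOf_eq_one] at hv'
    have : ∀ i, ∃ y, φ y = v i := fun i => by
      apply mem_range_of_pow_card φ.toRingHom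
      rw [hcard]
      have := congrFun hv' i
      simpa using this
    choose w hw using this
    obtain rfl : (fun i => φ (w i)) = v := funext hw
    refine ⟨⟨w, ?_⟩, rfl⟩
    rw [hφ] at hv
    rw [Set.mem_ofPred_eq]
    funext i
    apply φ.injective
    simpa using congrFun hv i

/-- Points whose image under `F` is in their orbit. -/
def stableSub {G X : Type*} [Group G] [MulAction G X] (F : X → X)
    (hF : ∀ (g : G) x, F (g • x) = g • F x) : SubMulAction G X where
  carrier := {x | F x ∈ MulAction.orbit G x}
  smul_mem' := by
    rintro c x ⟨g, hg⟩
    refine ⟨c * g * c⁻¹, ?_⟩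
    simp only at hg
    simp [mul_smul, hF, hg]

theorem burnside_twist {G X : Type*} [Group G] [Fintype G] [MulAction G X] (F : X → X)
    (hF : ∀ (g : G) x, F (g • x) = g • F x) (c : ℕ) (hc0 : c ≠ 0)
    (hc : ∀ g : G, Nat.card {x | F x = g • x} = c) :
    Set.ncard {O : Set X | (∃ x, O = MulAction.orbit G x) ∧ F '' O = O} = c := by
  classical
  let Y := stableSub F hF
  have hY : ∀ y : Y, ∃ t : G, t • (y : X) = F y := fun y => y.2
  choose t ht using hY
  let e1 : (Σ g : G, {x | F x = g • x}) ≃ (Σ g : G, MulAction.fixedBy Y g) :=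
    { toFun := fun p => ⟨(t ⟨p.2.1, ⟨p.1, p.2.2.symm⟩⟩)⁻¹ * p.1, ⟨⟨p.2.1, ⟨p.1, p.2.2.symm⟩⟩, by
        rw [MulAction.mem_fixedBy]
        apply Subtype.ext
        rw [SubMulAction.val_smul, mul_smul, inv_smul_eq_iff, ht]
        exact p.2.2.symm⟩⟩
      invFun := fun p => ⟨t p.2.1 * p.1, ⟨p.2.1.1, by
        have := congrArg Subtype.val (MulAction.mem_fixedBy.1 p.2.2)
        rw [SubMulAction.val_smul] at this
        rw [Set.mem_ofPred_eq, mul_smul, this, ht]⟩⟩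
      left_inv := by
        rintro ⟨g, x, hx⟩
        refine Sigma.subtype_ext ?_ ?_ <;> simp
      right_inv := by
        rintro ⟨g, y, hy⟩
        refine Sigma.subtype_ext ?_ ?_ <;> simp }
  have hcard := Nat.card_congr (e1.trans (MulAction.sigmaFixedByEquivOrbitsProdGroup G Y))
  have : ∀ g : G, Finite {x | F x = g • x} := fun g =>
    Nat.finite_of_card_ne_zero (by rw [hc]; exact hc0)
  rw [Nat.card_sigma, Nat.card_prod, Finset.sum_congr rfl (fun g _ => hc g), Finset.sum_const,
    Finset.card_univ, Nat.card_eq_fintype_card (α := G), smul_eq_mul, mul_comm] at hcard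
  have hcard' := Nat.eq_of_mul_eq_mul_right Fintype.card_pos hcard
  rw [hcard', ← Nat.card_coe_set_eq]
  symm
  have hstab : ∀ x : X, F '' MulAction.orbit G x = MulAction.orbit G (F x) := by
    intro x
    ext z
    constructor
    · rintro ⟨_, ⟨g, rfl⟩, rfl⟩
      exact ⟨g, (hF g x).symm⟩
    · rintro ⟨g, rfl⟩
      exact ⟨g • x, ⟨g, rfl⟩, hF g x⟩
  have horb : ∀ y z : Y, (MulAction.orbitRel G Y) y z ↔
      MulAction.orbit G (y : X) = MulAction.orbit G (z : X) := by
    intro y z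
    rw [MulAction.orbitRel_apply, MulAction.orbit_eq_iff]
    constructor
    · rintro ⟨g, h⟩; exact ⟨g, congrArg Subtype.val h⟩
    · rintro ⟨g, h⟩; exact ⟨g, Subtype.ext h⟩
  refine Nat.card_eq_of_bijective (Quotient.lift (fun y : Y => ⟨MulAction.orbit G (y : X),
    ⟨_, rfl⟩, ?_⟩) ?_) ⟨?_, ?_⟩
  · rw [hstab, MulAction.orbit_eq_iff]; exact y.2
  · intro y z h
    exact Subtype.ext ((horb y z).1 h)
  · intro a b
    induction a using Quotient.inductionOn with | _ y
    induction b using Quotient.inductionOn with | _ z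
    intro h
    exact Quotient.sound ((horb y z).2 (congrArg Subtype.val h))
  · rintro ⟨_, ⟨x, rfl⟩, h⟩
    rw [hstab, MulAction.orbit_eq_iff] at h
    exact ⟨Quotient.mk _ ⟨x, h⟩, rfl⟩

theorem projFrob_mk (k : Type*) [Field k] [Fintype k] (n : ℕ) (v : Fin n → AlgebraicClosure k)
    (hv : v ≠ 0) (hv' : (fun i => v i ^ Fintype.card k) ≠ 0) :
    projFrob k n (Projectivization.mk _ v hv) =
      Projectivization.mk _ (fun i => v i ^ Fintype.card k) hv' := by
  unfold projFrob
  rw [Projectivization.mk_eq_mk_iff']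
  obtain ⟨a, ha⟩ := Projectivization.exists_smul_eq_mk_rep (AlgebraicClosure k) v hv
  refine ⟨(a : AlgebraicClosure k) ^ Fintype.card k, ?_⟩
  funext i
  rw [← ha]
  simp [Units.smul_def, mul_pow]

theorem projFrob_iter_mk (k : Type*) [Field k] [Fintype k] (n m : ℕ)
    (v : Fin n → AlgebraicClosure k)
    (hv : v ≠ 0) (hv' : (fun i => v i ^ Fintype.card k ^ m) ≠ 0) :
    (projFrob k n)^[m] (Projectivization.mk _ v hv) =
      Projectivization.mk _ (fun i => v i ^ Fintype.card k ^ m) hv' := by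
  induction m generalizing v with
  | zero => simp
  | succ m ih =>
    have h1 : (fun i => v i ^ Fintype.card k) ≠ 0 := by
      intro h
      apply hv
      funext i
      have := congrFun h i
      simpa [Fintype.card_ne_zero] using this
    rw [Function.iterate_succ_apply, projFrob_mk k n v hv h1, ih]
    · congr 1; funext i; rw [← pow_mul, pow_succ']
    · intro h
      apply hv'
      funext i
      have := congrFun h i
      rw [pow_succ', pow_mul]; exact this

theorem gl_mulVec_ne_zero {k : Type*} [Field k] {n : ℕ}
    (g : Matrix.GeneralLinearGroup (Fin n) k) {A : Type*} [Field A] [Algebra k A]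
    {v : Fin n → A} (hv : v ≠ 0) :
    ((g : Matrix (Fin n) (Fin n) k).map (algebraMap k A)).mulVec v ≠ 0 := by
  intro h
  apply hv
  have hBA : ((g⁻¹ : Matrix.GeneralLinearGroup (Fin n) k) : Matrix (Fin n) (Fin n) k).map
      (algebraMap k A) * ((g : Matrix (Fin n) (Fin n) k)).map (algebraMap k A) = 1 := by
    rw [← Matrix.map_mul, ← Units.val_mul, inv_mul_cancel g]
    simp
  rw [← Matrix.one_mulVec v, ← hBA, ← Matrix.mulVec_mulVec, h, Matrix.mulVec_zero]

theorem projGamma_mk (k : Type*) [Field k] [Fintype k] (n : ℕ)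
    (g : Matrix.GeneralLinearGroup (Fin n) k) (v : Fin n → AlgebraicClosure k) (hv : v ≠ 0) :
    projGamma k n g (Projectivization.mk _ v hv) =
      Projectivization.mk _ _ (gl_mulVec_ne_zero g hv) := by
  unfold projGamma
  rw [Projectivization.mk_eq_mk_iff']
  obtain ⟨a, ha⟩ := Projectivization.exists_smul_eq_mk_rep (AlgebraicClosure k) v hv
  refine ⟨(a : AlgebraicClosure k), ?_⟩
  rw [← ha, Units.smul_def, Matrix.mulVec_smul]

/-- The action of `GL` on projective space given by `projGamma`. -/
noncomputable abbrev gammaAction (k : Type*) [Field k] [Fintype k] (n : ℕ) :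
    MulAction (Matrix.GeneralLinearGroup (Fin n) k)
      (Projectivization (AlgebraicClosure k) (Fin n → AlgebraicClosure k)) where
  smul g P := projGamma k n g P
  one_smul P := by
    change projGamma k n 1 P = P
    induction P using Projectivization.ind with | _ v hv
    rw [projGamma_mk]
    congr 1
    simp
  mul_smul g h P := by
    change projGamma k n (g * h) P = projGamma k n g (projGamma k n h P)
    induction P using Projectivization.ind with | _ v hv
    rw [projGamma_mk, projGamma_mk, projGamma_mk]
    congr 1
    rw [Matrix.mulVec_mulVec, Units.val_mul, Matrix.map_mul]

theorem pow_vec_ne_zero {A : Type*} [Field A] {n Q : ℕ} (hQ : Q ≠ 0) {v : Fin n → A} (hv : v ≠ 0) :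
    (fun i => v i ^ Q) ≠ 0 := by
  intro h
  apply hv
  funext i
  have := congrFun h i
  simpa [hQ] using this

theorem projFrob_iter_gamma (k : Type*) [Field k] [Fintype k] (n m : ℕ)
    (g : Matrix.GeneralLinearGroup (Fin n) k)
    (P : Projectivization (AlgebraicClosure k) (Fin n → AlgebraicClosure k)) :
    (projFrob k n)^[m] (projGamma k n g P) = projGamma k n g ((projFrob k n)^[m] P) := by
  have hcomm : Function.Commute (projFrob k n) (projGamma k n g) := by
    intro P
    induction P using Projectivization.ind with | _ v hv
    have hQ := Fintype.card_ne_zero (α := k)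
    rw [projGamma_mk, projFrob_mk _ _ _ _ (pow_vec_ne_zero hQ (gl_mulVec_ne_zero g hv)),
      projFrob_mk _ _ _ _ (pow_vec_ne_zero hQ hv), projGamma_mk]
    congr 1
    funext i
    simp only [Matrix.mulVec, dotProduct]
    have := map_sum (FiniteField.frobeniusAlgHom k (AlgebraicClosure k))
      (fun x => (g : Matrix (Fin n) (Fin n) k).map
        (algebraMap k (AlgebraicClosure k)) i x * v x) Finset.univ
    simp only [FiniteField.frobeniusAlgHom_apply] at this
    rw [this]
    simp [mul_pow, ← map_pow, FiniteField.pow_card]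
  exact (hcomm.iterate_left m) P

theorem card_twisted_points (k : Type*) [Field k] [Fintype k] (N m : ℕ) (hm : 1 ≤ m)
    (g : Matrix.GeneralLinearGroup (Fin (N + 1)) k) :
    Nat.card {P | (projFrob k (N + 1))^[m] P = projGamma k (N + 1) g P} =
      ∑ j ∈ Finset.range (N + 1), Fintype.card k ^ (m * j) := by
  classical
  obtain ⟨K, _, _, _, hcard, hrank⟩ := exists_ext k m (by omega)
  have hfin : Module.Finite k K := Module.Finite.of_finite
  let φ : K →ₐ[k] AlgebraicClosure k := IsAlgClosed.lift
  let _ : Algebra K (AlgebraicClosure k) := φ.toRingHom.toAlgebra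
  have hφ : ∀ x, algebraMap K (AlgebraicClosure k) x = φ x := fun x => rfl
  set A := AlgebraicClosure k
  set Q := Fintype.card K with hQdef
  have hQ1 : 1 < Q := Fintype.one_lt_card
  let gK : Matrix.GeneralLinearGroup (Fin (N + 1)) K :=
    Matrix.GeneralLinearGroup.map (algebraMap k K) g
  have hgK : (gK : Matrix (Fin (N + 1)) (Fin (N + 1)) K).map (algebraMap K A) =
      (g : Matrix (Fin (N + 1)) (Fin (N + 1)) k).map (algebraMap k A) := by
    ext i j
    simp only [gK, Matrix.map_apply, Matrix.GeneralLinearGroup.map_apply]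
    exact φ.commutes _
  have hV := twist_A (A := A) gK
  rw [hgK] at hV
  set M := (g : Matrix (Fin (N + 1)) (Fin (N + 1)) k).map (algebraMap k A) with hM
  set V := {v : Fin (N + 1) → A | (fun i => v i ^ Fintype.card K) = M.mulVec v} with hVdef
  have hVfin : Finite V := Nat.finite_of_card_ne_zero (by rw [hV]; positivity)
  set Fx := {P | (projFrob k (N + 1))^[m] P = projGamma k (N + 1) g P} with hFx
  have hmk : ∀ (v : Fin (N + 1) → A) (hv : v ≠ 0), Projectivization.mk A v hv ∈ Fx ↔
      ∃ a : A, a • M.mulVec v = fun i => v i ^ Q := by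
    intro v hv
    have h1 : (fun i => v i ^ Fintype.card k ^ m) ≠ 0 :=
      pow_vec_ne_zero (pow_ne_zero _ Fintype.card_ne_zero) hv
    rw [hFx, Set.mem_ofPred_eq, projFrob_iter_mk _ _ _ _ _ h1, projGamma_mk,
      Projectivization.mk_eq_mk_iff', hcard]
  -- choose good lifts
  have lift : ∀ P : Fx, ∃ v : Fin (N + 1) → A, ∃ hv : v ≠ 0, v ∈ V ∧
      Projectivization.mk A v hv = P.1 := by
    rintro ⟨P, hP⟩
    induction P using Projectivization.ind with | _ v hv
    obtain ⟨a, ha⟩ := (hmk v hv).1 hP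
    have ha0 : a ≠ 0 := by
      rintro rfl
      rw [zero_smul] at ha
      exact pow_vec_ne_zero (by omega) hv ha.symm
    obtain ⟨c, hc⟩ := IsAlgClosed.exists_pow_nat_eq (a⁻¹) (n := Q - 1) (by omega)
    have hc0 : c ≠ 0 := by
      rintro rfl
      rw [zero_pow (by omega)] at hc
      exact inv_ne_zero ha0 hc.symm
    refine ⟨c • v, smul_ne_zero hc0 hv, ?_, ?_⟩
    · rw [hVdef, Set.mem_ofPred_eq, Matrix.mulVec_smul]
      funext i
      have h2 := congrFun ha i
      simp only [Pi.smul_apply, smul_eq_mul] at h2 ⊢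
      rw [mul_pow, ← hQdef, ← h2]
      have h3 : c ^ Q = a⁻¹ * c := by
        rw [← hc, ← pow_succ]; congr 1; omega
      rw [h3]
      linear_combination (c * M.mulVec v i) * inv_mul_cancel₀ ha0
    · rw [Projectivization.mk_eq_mk_iff']
      exact ⟨c, rfl⟩
  choose s hs0 hsV hsP using lift
  have hKpow : ∀ ζ : K, φ ζ ^ Q = φ ζ := fun ζ => by
    rw [← map_pow, FiniteField.pow_card]
  let f : Option (Fx × Kˣ) → V := fun o => o.elim ⟨0, by
      rw [hVdef, Set.mem_ofPred_eq, Matrix.mulVec_zero]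
      funext i
      simp [Fintype.card_ne_zero]⟩ (fun p => ⟨φ (p.2 : K) • s p.1, by
      have h := hsV p.1
      rw [hVdef, Set.mem_ofPred_eq] at h ⊢
      rw [Matrix.mulVec_smul, ← h]
      funext i
      simp only [Pi.smul_apply, smul_eq_mul]
      rw [mul_pow, hKpow]⟩)
  have hφ0 : ∀ u : Kˣ, φ (u : K) ≠ 0 := fun u => by simp
  have hne : ∀ p : Fx × Kˣ, φ (p.2 : K) • s p.1 ≠ 0 := fun p => smul_ne_zero (hφ0 _) (hs0 _)
  have hf : Function.Bijective f := by
    constructor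
    · rintro (_ | ⟨P, u⟩) (_ | ⟨P', u'⟩) h
      · rfl
      · exact absurd (congrArg Subtype.val h).symm (hne (P', u'))
      · exact absurd (congrArg Subtype.val h) (hne (P, u))
      · have h' : φ (u : K) • s P = φ (u' : K) • s P' := congrArg Subtype.val h
        have hPP : P = P' := by
          apply Subtype.ext
          rw [← hsP P, ← hsP P', Projectivization.mk_eq_mk_iff']
          refine ⟨(φ (u : K))⁻¹ * φ (u' : K), ?_⟩
          rw [mul_smul, ← h', smul_smul, inv_mul_cancel₀ (hφ0 u), one_smul]
        subst hPP
        have := smul_left_injective A (hs0 P) h'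
        have := Units.ext (φ.injective this)
        rw [this]
    · rintro ⟨v, hv⟩
      by_cases hv0 : v = 0
      · exact ⟨none, Subtype.ext hv0.symm⟩
      have hP : Projectivization.mk A v hv0 ∈ Fx := (hmk v hv0).2 ⟨1, by
        rw [one_smul]; exact hv.symm⟩
      have h1 := hsP ⟨_, hP⟩
      have h1 := h1.symm
      simp only at h1
      rw [Projectivization.mk_eq_mk_iff'] at h1
      obtain ⟨a, ha⟩ := h1
      have ha0 : a ≠ 0 := by
        rintro rfl
        rw [zero_smul] at ha
        exact hv0 ha.symm
      have hsv := hsV ⟨_, hP⟩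
      set w := s ⟨_, hP⟩ with hw
      have hw0 : w ≠ 0 := hs0 _
      have haQ : a ^ Q = a := by
        have hMw : M.mulVec w ≠ 0 := gl_mulVec_ne_zero g hw0
        apply smul_left_injective A hMw
        change a ^ Q • M.mulVec w = a • M.mulVec w
        rw [← Matrix.mulVec_smul M a, ha]
        rw [hVdef, Set.mem_ofPred_eq] at hv hsv
        rw [← hv, ← hsv, ← ha]
        funext i
        simp [mul_pow, hQdef]
      obtain ⟨ζ, hζ⟩ := mem_range_of_pow_card φ.toRingHom a haQ
      have hζ0 : ζ ≠ 0 := by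
        rintro rfl
        rw [map_zero] at hζ
        exact ha0 hζ.symm
      refine ⟨some (⟨_, hP⟩, Units.mk0 ζ hζ0), Subtype.ext ?_⟩
      change φ ζ • w = v
      rw [← ha, ← hζ]; rfl
  have hOfin : Finite (Option (Fx × Kˣ)) := Finite.of_injective f hf.1
  have hPfin : Finite (Fx × Kˣ) := Finite.of_injective (some : _ → Option (Fx × Kˣ))
    (Option.some_injective _)
  have hc := Nat.card_eq_of_bijective f hf
  rw [hV, Finite.card_option, Nat.card_prod, Nat.card_eq_fintype_card (α := Kˣ),
    Fintype.card_units, ← hQdef] at hc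
  have hgeom := Nat.geomSum_eq (m := Q) hQ1 (N + 1)
  have hsum : ∑ j ∈ Finset.range (N + 1), Fintype.card k ^ (m * j) =
      ∑ j ∈ Finset.range (N + 1), Q ^ j := by
    simp only [hcard, pow_mul]
  rw [hsum, hgeom, ← hc, Nat.add_sub_cancel, Nat.mul_div_cancel _ (by omega)]

theorem stmt14 (k : Type*) [Field k] [Fintype k] (q N : ℕ)
    (hq : Fintype.card k = q)
    (γ : Matrix.GeneralLinearGroup (Fin (N + 1)) k)
    (m : ℕ) (hm : 1 ≤ m) :
    Set.ncard {O : Set (Projectivization (AlgebraicClosure k)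
        (Fin (N + 1) → AlgebraicClosure k)) |
      (∃ P, O = projOrbit k (N + 1) γ P) ∧ (projFrob k (N + 1))^[m] '' O = O} =
      ∑ j ∈ Finset.range (N + 1), q ^ (m * j) := by
  classical
  subst hq
  letI := gammaAction k (N + 1)
  have horb : ∀ P, projOrbit k (N + 1) γ P = MulAction.orbit (Subgroup.zpowers γ) P := by
    intro P
    ext R
    constructor
    · rintro ⟨i, rfl⟩
      exact ⟨⟨γ ^ i, i, rfl⟩, rfl⟩
    · rintro ⟨⟨_, i, rfl⟩, rfl⟩
      exact ⟨i, rfl⟩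
  simp only [horb]
  letI : Fintype (Subgroup.zpowers γ) := Fintype.ofFinite _
  refine burnside_twist (G := Subgroup.zpowers γ) _ ?_ _ ?_ ?_
  · intro g x
    exact projFrob_iter_gamma k (N + 1) m g.1 x
  · rw [Finset.sum_range_succ']
    simp
  · intro g
    exact card_twisted_points k N m hm g.1
end

section
/- Let γ ∈ GL_{N+1}(𝔽_q), regarded as a k̄-linear automorphism of k̄^{N+1}, with set of eigenvalues VP_γ = {λ₁, …, λ_s} ⊆ k̄, where m_i denotes the multiplicity of (x − λ_i) in the minimal polynomial of γ and δ_i = ⌈log_p(m_i)⌉. For a nonempty subset Λ ⊆ VP_γ set D(Λ) = min{ d ≥ 1 : λ^d = μ^d for all λ, μ ∈ Λ }, δ(Λ) = max{ δ_i : λ_i ∈ Λ }, and V_Λ^{(ν)} = ⊕_{λ ∈ Λ} ker((γ − λ)^{p^ν}) for 0 ≤ ν ≤ δ(Λ); call Λ D-proper if D(Δ) > D(Λ) for every subset Δ of VP_γ strictly containing Λ. Then a nonzero γ-invariant subspace V ⊆ k̄^{N+1} is proper if and only if V = V_Λ^{(ν)} for some D-proper Λ ⊆ VP_γ and some integer ν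 with 0 ≤ ν ≤ δ(Λ). -/
/-- The `k̄`-linear endomorphism of `k̄^m` induced by a matrix
`γ ∈ GL_m(𝔽_q)` via base extension. -/
noncomputable def matEnd (k : Type*) [Field k] [Fintype k] (m : ℕ)
    (γ : Matrix.GeneralLinearGroup (Fin m) k) :
    Module.End (AlgebraicClosure k) (Fin m → AlgebraicClosure k) :=
  Matrix.mulVecLin
    ((γ : Matrix (Fin m) (Fin m) k).map (algebraMap k (AlgebraicClosure k)))

/-- `V` is a `γ`-invariant subspace: `γ(V) = V`. -/
def IsInvt (k : Type*) [Field k] [Fintype k] (m : ℕ)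
    (γ : Matrix.GeneralLinearGroup (Fin m) k)
    (V : Submodule (AlgebraicClosure k) (Fin m → AlgebraicClosure k)) : Prop :=
  Submodule.map (matEnd k m γ) V = V

/-- The exponent of `V`: the least `e ≥ 1` such that `γ^e` acts on `V` as
multiplication by a scalar. -/
noncomputable def expV (k : Type*) [Field k] [Fintype k] (m : ℕ)
    (γ : Matrix.GeneralLinearGroup (Fin m) k)
    (V : Submodule (AlgebraicClosure k) (Fin m → AlgebraicClosure k)) : ℕ :=
  sInf {e : ℕ | 1 ≤ e ∧ ∃ c : AlgebraicClosure k,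
    ∀ v ∈ V, (matEnd k m γ ^ e) v = c • v}

/-- `V` is a proper `γ`-invariant subspace. -/
def IsProper (k : Type*) [Field k] [Fintype k] (m : ℕ)
    (γ : Matrix.GeneralLinearGroup (Fin m) k)
    (V : Submodule (AlgebraicClosure k) (Fin m → AlgebraicClosure k)) : Prop :=
  V ≠ ⊥ ∧ IsInvt k m γ V ∧
    ∀ W : Submodule (AlgebraicClosure k) (Fin m → AlgebraicClosure k),
      W ≠ ⊥ → IsInvt k m γ W → V < W → expV k m γ V < expV k m γ W

/-- The set `VP_γ` of eigenvalues of `γ` on `k̄^m`. -/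
def specOf (k : Type*) [Field k] [Fintype k] (m : ℕ)
    (γ : Matrix.GeneralLinearGroup (Fin m) k) : Set (AlgebraicClosure k) :=
  {μ | Module.End.HasEigenvalue (matEnd k m γ) μ}

/-- The multiplicity `m_i` of `(x − μ)` in the minimal polynomial of `γ`. -/
noncomputable def multOf (k : Type*) [Field k] [Fintype k] (m : ℕ)
    (γ : Matrix.GeneralLinearGroup (Fin m) k) (μ : AlgebraicClosure k) : ℕ :=
  (minpoly (AlgebraicClosure k) (matEnd k m γ)).rootMultiplicity μ

/-- `δ_i = ⌈log_p m_i⌉`: the least `ν ≥ 0` with `p^ν ≥ m_i`, `p = char k`. -/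
noncomputable def deltaOf (k : Type*) [Field k] [Fintype k] (m : ℕ)
    (γ : Matrix.GeneralLinearGroup (Fin m) k) (μ : AlgebraicClosure k) : ℕ :=
  sInf {ν : ℕ | multOf k m γ μ ≤ ringChar k ^ ν}

/-- `D(Λ) = min{d ≥ 1 : λ^d = μ^d for all λ, μ ∈ Λ}`. -/
noncomputable def DOf (k : Type*) [Field k] [Fintype k]
    (Λ : Set (AlgebraicClosure k)) : ℕ :=
  sInf {d : ℕ | 1 ≤ d ∧ ∀ μ ∈ Λ, ∀ μ' ∈ Λ, μ ^ d = μ' ^ d}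

/-- `δ(Λ) = max{δ_i : λ_i ∈ Λ}`. -/
noncomputable def deltaSet (k : Type*) [Field k] [Fintype k] (m : ℕ)
    (γ : Matrix.GeneralLinearGroup (Fin m) k)
    (Λ : Set (AlgebraicClosure k)) : ℕ :=
  sSup (deltaOf k m γ '' Λ)

/-- `V_Λ^{(ν)} = ⊕_{λ ∈ Λ} ker((γ − λ)^{p^ν})`. -/
noncomputable def VLam (k : Type*) [Field k] [Fintype k] (m : ℕ)
    (γ : Matrix.GeneralLinearGroup (Fin m) k)
    (Λ : Set (AlgebraicClosure k)) (ν : ℕ) :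
    Submodule (AlgebraicClosure k) (Fin m → AlgebraicClosure k) :=
  ⨆ μ ∈ Λ, LinearMap.ker ((matEnd k m γ - μ • 1) ^ (ringChar k ^ ν))

/-- `Λ` is `D`-proper: a nonempty set of eigenvalues such that every
strictly larger set of eigenvalues has strictly larger `D`. -/
def DProper (k : Type*) [Field k] [Fintype k] (m : ℕ)
    (γ : Matrix.GeneralLinearGroup (Fin m) k)
    (Λ : Set (AlgebraicClosure k)) : Prop :=
  Λ.Nonempty ∧ Λ ⊆ specOf k m γ ∧
    ∀ Δ : Set (AlgebraicClosure k), Δ ⊆ specOf k m γ → Λ ⊂ Δ →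
      DOf k Λ < DOf k Δ

open Polynomial in
lemma aux_aeval {K E : Type*} [Field K] [AddCommGroup E] [Module K E] (f : Module.End K E) (μ : K) :
    aeval f (X - C μ) = f - μ • 1 := by
  simp [Algebra.algebraMap_eq_smul_one]

open Polynomial in
lemma aux_aeval2 {K E : Type*} [Field K] [AddCommGroup E] [Module K E] (f : Module.End K E) (c : K)
    (n : ℕ) (v : E) : aeval f (X ^ n - C c) v = (f ^ n) v - c • v := by
  simp [Algebra.algebraMap_eq_smul_one]

open Polynomial in
lemma aux_coprime {K E : Type*} [Field K] [AddCommGroup E] [Module K E] (f : Module.End K E) (μ : K)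
    (q : K[X]) (hq : q.eval μ ≠ 0) (n : ℕ) (w : E) (h1 : aeval f q w = 0)
    (h2 : ((f - μ • 1) ^ n) w = 0) : w = 0 := by
  have hc : IsCoprime q ((X - C μ) ^ n) := by
    apply IsCoprime.pow_right
    apply IsCoprime.symm
    apply (irreducible_X_sub_C μ).coprime_iff_not_dvd.2
    rw [dvd_iff_isRoot]; exact hq
  obtain ⟨a, b, hab⟩ := hc
  have := congrArg (fun r => aeval f r w) hab
  simp only [map_add, map_mul, map_pow, aux_aeval, LinearMap.add_apply, Module.End.mul_apply,
    h1, h2, map_zero, map_one, Module.End.one_apply, add_zero] at this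
  exact this.symm

/-- `f v` eigen => all powers. -/
lemma aux_pow_scalar {K E : Type*} [Field K] [AddCommGroup E] [Module K E] (f : Module.End K E)
    (p : ℕ) [Fact p.Prime] [CharP K p] (μ : K) (d ν : ℕ) (v : E)
    (hv : ((f - μ • 1) ^ (p ^ ν)) v = 0) :
    (f ^ (d * p ^ ν)) v = μ ^ (d * p ^ ν) • v := by
  have hdvd : (Polynomial.X - Polynomial.C μ) ^ (p ^ ν) ∣
      (Polynomial.X ^ (d * p ^ ν) - Polynomial.C (μ ^ (d * p ^ ν))) := by
    rw [pow_mul, pow_mul μ, Polynomial.C_pow (a := μ ^ d), ← sub_pow_char_pow (p := p), Polynomial.C_pow]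
    exact pow_dvd_pow_of_dvd (sub_dvd_pow_sub_pow _ _ _) _
  obtain ⟨g, hg⟩ := hdvd
  rw [← sub_eq_zero, ← aux_aeval2, hg, mul_comm, map_mul, map_pow, aux_aeval,
    Module.End.mul_apply, hv, map_zero]

open Polynomial in
lemma aux_B {K E : Type*} [Field K] [AddCommGroup E] [Module K E] (f : Module.End K E)
    (p : ℕ) [Fact p.Prime] [CharP K p] (μ : K) (hμ : μ ≠ 0) (d a : ℕ) (hd : ¬ p ∣ d) (v : E) (n : ℕ)
    (hv : ((f - μ • 1) ^ n) v = 0) (h : (f ^ (d * p ^ a)) v = μ ^ (d * p ^ a) • v) :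
    ((f - μ • 1) ^ (p ^ a)) v = 0 := by
  obtain ⟨g, hg⟩ : (X - C μ) ∣ (X ^ d - C (μ ^ d)) := by
    rw [C_pow]; exact sub_dvd_pow_sub_pow _ _ _
  have hgμ : g.eval μ ≠ 0 := by
    have := congrArg (fun r => (derivative r).eval μ) hg
    simp only [derivative_sub, derivative_C, derivative_X_pow, derivative_mul,
      eval_add, eval_mul, eval_sub, eval_X, eval_C, eval_pow, sub_self, zero_mul, sub_zero, one_mul,
      add_zero, derivative_X] at this
    rw [← this]
    refine mul_ne_zero ?_ (pow_ne_zero _ hμ)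
    rwa [Ne, CharP.cast_eq_zero_iff K p]
  apply aux_coprime f μ (g ^ p ^ a) (by rw [eval_pow]; exact pow_ne_zero _ hgμ) n
  · have e : g ^ p ^ a * (X - C μ) ^ p ^ a = X ^ (d * p ^ a) - C (μ ^ (d * p ^ a)) := by
      rw [← mul_pow, mul_comm, ← hg, sub_pow_char_pow, pow_mul, pow_mul μ, C_pow (a := μ ^ d)]
    rw [← aux_aeval, ← map_pow, ← Module.End.mul_apply, ← map_mul, e, aux_aeval2, h, sub_self]
  · rw [← Module.End.mul_apply, ← pow_add, add_comm, pow_add, Module.End.mul_apply, hv, map_zero]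

/-- A nonzero element of a generalized eigenspace yields an eigenvector. -/
lemma aux_eigvec {K E : Type*} [Field K] [AddCommGroup E] [Module K E] (f : Module.End K E)
    (μ : K) (U : Submodule K E) (hU : ∀ x ∈ U, f x ∈ U) (n : ℕ) : ∀ (v : E), v ∈ U → v ≠ 0 →
    ((f - μ • 1) ^ n) v = 0 → ∃ w ∈ U, w ≠ 0 ∧ f w = μ • w := by
  induction n with
  | zero => intro v _ h0 h; simp at h; exact absurd h h0
  | succ n ih =>
    intro v hv h0 h
    by_cases h1 : f v = μ • v
    · exact ⟨v, hv, h0, h1⟩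
    · refine ih ((f - μ • 1) v) ?_ ?_ ?_
      · simpa using U.sub_mem (hU v hv) (U.smul_mem μ hv)
      · simpa [sub_eq_zero] using h1
      · rwa [pow_succ, Module.End.mul_apply] at h

lemma aux_eig_pow {K E : Type*} [Field K] [AddCommGroup E] [Module K E] (f : Module.End K E)
    (μ : K) (v : E) (h : f v = μ • v) (n : ℕ) : (f ^ n) v = μ ^ n • v := by
  induction n with
  | zero => simp
  | succ n ih => rw [pow_succ, Module.End.mul_apply, h, map_smul, ih, smul_smul, pow_succ, mul_comm]

lemma aux_A {K E : Type*} [Field K] [IsAlgClosed K] [AddCommGroup E] [Module K E]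
    [FiniteDimensional K E] (f : Module.End K E)
    (p : ℕ) [Fact p.Prime] [CharP K p] (hf : Function.Injective f) (c : K) (d a : ℕ) (hd : ¬ p ∣ d)
    (W : Submodule K E) (hW : ∀ x ∈ W, f x ∈ W)
    (h : ∀ v ∈ W, (f ^ (d * p ^ a)) v = c • v) :
    W ≤ ⨆ μ ∈ {μ : K | f.HasEigenvalue μ ∧ μ ^ (d * p ^ a) = c},
      LinearMap.ker ((f - μ • 1) ^ (p ^ a)) := by
  have h1 : W = ⨆ μ : K, W ⊓ f.maxGenEigenspace μ := by
    rw [← Submodule.inf_iSup_genEigenspace hW]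
    change _ = W ⊓ ⨆ μ : K, f.maxGenEigenspace μ
    rw [Module.End.iSup_maxGenEigenspace_eq_top, inf_top_eq]
  rw [h1]
  refine iSup_le fun μ => ?_
  rintro v ⟨hvW, hv⟩
  obtain ⟨n, hn⟩ := (Module.End.mem_maxGenEigenspace f μ v).1 hv
  by_cases h0 : v = 0
  · rw [h0]; exact Submodule.zero_mem _
  obtain ⟨w, hwW, hw0, hw⟩ := aux_eigvec f μ W hW n v hvW h0 hn
  have hμc : μ ^ (d * p ^ a) = c := by
    have := aux_eig_pow f μ w hw (d * p ^ a)
    rw [h w hwW] at this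
    exact (smul_left_injective K hw0 this).symm
  have hμ0 : μ ≠ 0 := by
    rintro rfl
    rw [zero_smul] at hw
    exact hw0 (hf (by rw [hw, map_zero]))
  refine Submodule.mem_iSup_of_mem μ (Submodule.mem_iSup_of_mem ⟨?_, hμc⟩ ?_)
  · exact Module.End.hasEigenvalue_of_hasEigenvector
      (Module.End.hasEigenvector_iff.2 ⟨Module.End.mem_eigenspace_iff.2 hw, hw0⟩)
  · exact aux_B f p μ hμ0 d a hd v n hn (by rw [hμc]; exact h v hvW)

open Polynomial in
lemma aux_mult_le {K E : Type*} [Field K] [AddCommGroup E] [Module K E] [FiniteDimensional K E]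
    (f : Module.End K E) (μ : K) (n : ℕ) (v : E) (hv : ((f - μ • 1) ^ n) v = 0) (j : ℕ)
    (hj : (minpoly K f).rootMultiplicity μ ≤ j) : ((f - μ • 1) ^ j) v = 0 := by
  have hne : minpoly K f ≠ 0 := minpoly.ne_zero (Algebra.IsIntegral.isIntegral f)
  obtain ⟨q, hq, hq'⟩ := exists_eq_pow_rootMultiplicity_mul_and_not_dvd _ hne μ
  rw [dvd_iff_isRoot] at hq'
  refine aux_coprime f μ q hq' n _ ?_ ?_
  · obtain ⟨i, rfl⟩ := Nat.exists_eq_add_of_le hj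
    have e : q * (X - C μ) ^ ((minpoly K f).rootMultiplicity μ + i) =
        (X - C μ) ^ i * minpoly K f := by
      conv_rhs => rw [hq]
      ring
    rw [← Module.End.mul_apply, ← aux_aeval, ← map_pow, ← map_mul, e, map_mul, minpoly.aeval,
      mul_zero, LinearMap.zero_apply]
  · rw [← Module.End.mul_apply, ← pow_add, add_comm, pow_add, Module.End.mul_apply, hv, map_zero]

open Polynomial in
lemma aux_mult_ge {K E : Type*} [Field K] [AddCommGroup E] [Module K E] [FiniteDimensional K E]
    (f : Module.End K E) (μ : K) (j i : ℕ) (hij : j < i)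
    (h : ∀ v, ((f - μ • 1) ^ i) v = 0 → ((f - μ • 1) ^ j) v = 0) :
    (minpoly K f).rootMultiplicity μ ≤ j := by
  have hne : minpoly K f ≠ 0 := minpoly.ne_zero (Algebra.IsIntegral.isIntegral f)
  obtain ⟨q, hq, hq'⟩ := exists_eq_pow_rootMultiplicity_mul_and_not_dvd _ hne μ
  by_contra! hlt
  set m := (minpoly K f).rootMultiplicity μ with hm
  have hstep : ∀ n, ∀ v, ((f - μ • 1) ^ (j + n)) v = 0 → ((f - μ • 1) ^ j) v = 0 := by
    intro n
    induction n with
    | zero => intro v hv; simpa using hv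
    | succ n ih =>
      intro v hv
      apply h
      have h2 := ih ((f - μ • 1) v) (by rw [← Module.End.mul_apply, ← pow_succ]; exact hv)
      rw [← Module.End.mul_apply, ← pow_succ] at h2
      obtain ⟨t, rfl⟩ := Nat.exists_eq_add_of_lt hij
      rw [show j + t + 1 = t + (j + 1) by ring, pow_add, Module.End.mul_apply, h2, map_zero]
  obtain ⟨n, hn⟩ := Nat.exists_eq_add_of_lt hlt
  have hz : aeval f ((X - C μ) ^ j * q) = 0 := by
    ext1 v
    rw [map_mul, map_pow, aux_aeval, Module.End.mul_apply]
    apply hstep (n + 1)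
    rw [← add_assoc, ← hn, ← Module.End.mul_apply, ← aux_aeval, ← map_pow, ← map_mul, ← hq,
      minpoly.aeval, LinearMap.zero_apply]
  have hd := minpoly.dvd K f hz
  rw [hq] at hd
  have hq0 : q ≠ 0 := by rintro rfl; simp at hq'
  have := (mul_dvd_mul_iff_right hq0).1 hd
  have h3 := natDegree_le_of_dvd this (pow_ne_zero _ (X_sub_C_ne_zero μ))
  rw [natDegree_pow, natDegree_pow, natDegree_X_sub_C] at h3
  omega

section basics
variable (k : Type*) [Field k] [Fintype k] (m : ℕ) (γ : Matrix.GeneralLinearGroup (Fin m) k)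

lemma aux_finite_order : ∃ n : ℕ, 1 ≤ n ∧ matEnd k m γ ^ n = 1 := by
  classical
  refine ⟨orderOf γ, orderOf_pos γ, ?_⟩
  have h := pow_orderOf_eq_one γ
  have h2 : (γ : Matrix (Fin m) (Fin m) k) ^ orderOf γ = 1 := by
    rw [← Units.val_pow_eq_pow_val, h, Units.val_one]
  have h3 : matEnd k m γ = Matrix.toLin'
      ((algebraMap k (AlgebraicClosure k)).mapMatrix (γ : Matrix (Fin m) (Fin m) k)) := rfl
  rw [h3, ← Matrix.toLin'_pow, ← map_pow, h2, map_one, Matrix.toLin'_one]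
  rfl

lemma aux_inj : Function.Injective (matEnd k m γ) := by
  obtain ⟨n, hn, h⟩ := aux_finite_order k m γ
  obtain ⟨j, rfl⟩ := Nat.exists_eq_add_of_le' hn
  intro x y hxy
  have : (matEnd k m γ ^ (j + 1)) x = (matEnd k m γ ^ (j + 1)) y := by
    rw [pow_succ, Module.End.mul_apply, Module.End.mul_apply, hxy]
  simpa [h] using this

lemma aux_spec_vec {μ : AlgebraicClosure k} (h : μ ∈ specOf k m γ) :
    ∃ v, v ≠ 0 ∧ matEnd k m γ v = μ • v := by
  obtain ⟨v, hv⟩ := Module.End.HasEigenvalue.exists_hasEigenvector h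
  exact ⟨v, hv.2, hv.apply_eq_smul⟩

lemma aux_spec_finite : (specOf k m γ).Finite := by
  have h := Module.End.finite_hasEigenvalue (matEnd k m γ)
  exact h

lemma aux_invt_mem {V} (h : IsInvt k m γ V) : ∀ x ∈ V, matEnd k m γ x ∈ V := by
  intro x hx
  have : matEnd k m γ x ∈ Submodule.map (matEnd k m γ) V := Submodule.mem_map_of_mem hx
  rwa [h] at this

lemma aux_invt_of_mem {V : Submodule (AlgebraicClosure k) (Fin m → AlgebraicClosure k)}
    (h : ∀ x ∈ V, matEnd k m γ x ∈ V) : IsInvt k m γ V := by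
  apply Submodule.eq_of_le_of_finrank_eq
  · rintro _ ⟨x, hx, rfl⟩; exact h x hx
  · exact (Submodule.equivMapOfInjective _ (aux_inj k m γ) V).finrank_eq.symm

lemma aux_exp_spec (V) : 1 ≤ expV k m γ V ∧ ∃ c : AlgebraicClosure k,
    ∀ v ∈ V, (matEnd k m γ ^ expV k m γ V) v = c • v := by
  obtain ⟨n, hn, h⟩ := aux_finite_order k m γ
  exact Nat.sInf_mem (s := {e : ℕ | 1 ≤ e ∧ ∃ c : AlgebraicClosure k,
    ∀ v ∈ V, (matEnd k m γ ^ e) v = c • v}) ⟨n, hn, 1, by simp [h]⟩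

lemma aux_exp_le {V} {e : ℕ} (he : 1 ≤ e) (c : AlgebraicClosure k)
    (h : ∀ v ∈ V, (matEnd k m γ ^ e) v = c • v) : expV k m γ V ≤ e :=
  Nat.sInf_le ⟨he, c, h⟩

lemma aux_D_spec {Λ} (hΛ : Λ ⊆ specOf k m γ) : 1 ≤ DOf k Λ ∧
    ∀ μ ∈ Λ, ∀ μ' ∈ Λ, μ ^ DOf k Λ = μ' ^ DOf k Λ := by
  obtain ⟨n, hn, h⟩ := aux_finite_order k m γ
  have h1 : ∀ μ ∈ Λ, μ ^ n = 1 := by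
    intro μ hμ
    obtain ⟨v, hv0, hv⟩ := aux_spec_vec k m γ (hΛ hμ)
    have := aux_eig_pow _ μ v hv n
    rw [h] at this
    refine (smul_left_injective _ hv0 ?_).symm
    simpa using this
  exact Nat.sInf_mem (s := {d : ℕ | 1 ≤ d ∧ ∀ μ ∈ Λ, ∀ μ' ∈ Λ, μ ^ d = μ' ^ d})
    ⟨n, hn, fun μ hμ μ' hμ' => by rw [h1 μ hμ, h1 μ' hμ']⟩

lemma aux_D_le {Λ : Set (AlgebraicClosure k)} {d : ℕ} (hd : 1 ≤ d)
    (h : ∀ μ ∈ Λ, ∀ μ' ∈ Λ, μ ^ d = μ' ^ d) : DOf k Λ ≤ d :=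
  Nat.sInf_le ⟨hd, h⟩

lemma aux_prime : Fact (ringChar k).Prime := ⟨CharP.char_is_prime k (ringChar k)⟩

lemma aux_delta_spec (μ : AlgebraicClosure k) :
    multOf k m γ μ ≤ ringChar k ^ deltaOf k m γ μ := by
  have := aux_prime k
  exact Nat.sInf_mem (s := {ν : ℕ | multOf k m γ μ ≤ ringChar k ^ ν})
    ⟨multOf k m γ μ, (Nat.lt_pow_self this.out.one_lt).le⟩

lemma aux_delta_le {μ : AlgebraicClosure k} {a : ℕ} (h : multOf k m γ μ ≤ ringChar k ^ a) :
    deltaOf k m γ μ ≤ a := Nat.sInf_le h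

lemma aux_delta_le_set {Λ} (hΛ : Λ ⊆ specOf k m γ) {μ} (hμ : μ ∈ Λ) :
    deltaOf k m γ μ ≤ deltaSet k m γ Λ :=
  le_csSup (((aux_spec_finite k m γ).subset hΛ).image _).bddAbove ⟨μ, hμ, rfl⟩

lemma aux_delta_attained {Λ} (hΛ : Λ ⊆ specOf k m γ) (h0 : Λ.Nonempty) :
    ∃ μ ∈ Λ, deltaOf k m γ μ = deltaSet k m γ Λ :=
  (h0.image _).csSup_mem (((aux_spec_finite k m γ).subset hΛ).image _)

lemma aux_VLam_scalar {Λ : Set (AlgebraicClosure k)} (d ν : ℕ) (c : AlgebraicClosure k)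
    (h : ∀ μ ∈ Λ, μ ^ (d * ringChar k ^ ν) = c) :
    ∀ v ∈ VLam k m γ Λ ν, (matEnd k m γ ^ (d * ringChar k ^ ν)) v = c • v := by
  have := aux_prime k
  have hle : VLam k m γ Λ ν ≤ LinearMap.ker (matEnd k m γ ^ (d * ringChar k ^ ν) - c • 1) := by
    refine iSup₂_le fun μ hμ v hv => ?_
    have h2 := aux_pow_scalar (matEnd k m γ) (ringChar k) μ d ν v hv
    rw [h μ hμ] at h2
    simp [h2]
  intro v hv
  have := hle hv
  simpa [sub_eq_zero] using this

lemma aux_ker_le_VLam {Λ : Set (AlgebraicClosure k)} (ν : ℕ) {μ} (hμ : μ ∈ Λ) {v}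
    (hv : ((matEnd k m γ - μ • 1) ^ (ringChar k ^ ν)) v = 0) : v ∈ VLam k m γ Λ ν :=
  Submodule.mem_iSup_of_mem μ (Submodule.mem_iSup_of_mem hμ hv)

lemma aux_eig_mem_VLam {Λ : Set (AlgebraicClosure k)} (ν : ℕ) {μ} (hμ : μ ∈ Λ) {v}
    (hv : matEnd k m γ v = μ • v) : v ∈ VLam k m γ Λ ν := by
  have hp := aux_prime k
  apply aux_ker_le_VLam k m γ ν hμ
  obtain ⟨j, hj⟩ := Nat.exists_eq_add_of_le' (Nat.one_le_pow ν _ hp.out.pos)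
  rw [hj, pow_succ, Module.End.mul_apply]
  simp [hv]

lemma aux_VLam_mono {Λ Δ : Set (AlgebraicClosure k)} (h : Λ ⊆ Δ) (ν : ℕ) :
    VLam k m γ Λ ν ≤ VLam k m γ Δ ν := biSup_mono h

lemma aux_VLam_invt (Λ : Set (AlgebraicClosure k)) (ν : ℕ) : IsInvt k m γ (VLam k m γ Λ ν) := by
  apply aux_invt_of_mem
  have : VLam k m γ Λ ν ≤ (VLam k m γ Λ ν).comap (matEnd k m γ) := by
    refine iSup₂_le fun μ hμ v hv => ?_
    apply aux_ker_le_VLam k m γ ν hμ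
    have hc : Commute ((matEnd k m γ - μ • 1) ^ (ringChar k ^ ν)) (matEnd k m γ) := by
      apply Commute.pow_left
      exact (Commute.refl _).sub_left ((Commute.one_left _).smul_left μ)
    rw [← Module.End.mul_apply, hc.eq, Module.End.mul_apply, LinearMap.mem_ker.1 hv, map_zero]
  exact this

/-- Decomposition of a subspace on which `γ^(d p^a)` is scalar. -/
lemma aux_le_VLam {W} (hW : IsInvt k m γ W) (d a : ℕ) (hd : ¬ ringChar k ∣ d)
    (c : AlgebraicClosure k) (h : ∀ v ∈ W, (matEnd k m γ ^ (d * ringChar k ^ a)) v = c • v) :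
    W ≤ VLam k m γ {μ | μ ∈ specOf k m γ ∧ μ ^ (d * ringChar k ^ a) = c} a := by
  have := aux_prime k
  exact aux_A (matEnd k m γ) (ringChar k) (aux_inj k m γ) c d a hd W (aux_invt_mem k m γ hW) h

lemma aux_pow_inj (x y : AlgebraicClosure k) (d a : ℕ)
    (h : x ^ (d * ringChar k ^ a) = y ^ (d * ringChar k ^ a)) : x ^ d = y ^ d := by
  have := aux_prime k
  rw [pow_mul, pow_mul, ← sub_eq_zero, ← sub_pow_char_pow] at h
  exact sub_eq_zero.1 (eq_zero_of_pow_eq_zero h)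

/-- The exponent of `V_Λ^{(ν)}` is at most `D(Λ) p^ν`. -/
lemma aux_exp_VLam_le {Λ} (hΛ : Λ ⊆ specOf k m γ) (h0 : Λ.Nonempty) (ν : ℕ) :
    expV k m γ (VLam k m γ Λ ν) ≤ DOf k Λ * ringChar k ^ ν := by
  have hp := aux_prime k
  obtain ⟨h1, h2⟩ := aux_D_spec k m γ hΛ
  obtain ⟨μ₀, hμ₀⟩ := h0
  refine aux_exp_le k m γ (Nat.mul_pos h1 (pow_pos hp.out.pos ν)) (μ₀ ^ (DOf k Λ * ringChar k ^ ν)) ?_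
  apply aux_VLam_scalar
  intro μ hμ
  rw [pow_mul, pow_mul, h2 μ hμ μ₀ hμ₀]

lemma aux_factor {e : ℕ} (he : 1 ≤ e) : ∃ d a, e = d * ringChar k ^ a ∧ ¬ ringChar k ∣ d := by
  have hp := aux_prime k
  obtain ⟨a, d, hd, h⟩ := Nat.exists_eq_pow_mul_and_not_dvd (n := e) (by omega) (ringChar k)
    hp.out.ne_one
  exact ⟨d, a, by rw [h, mul_comm], hd⟩

lemma aux_forward {V} (hV : IsProper k m γ V) :
    ∃ Λ : Set (AlgebraicClosure k), DProper k m γ Λ ∧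
        ∃ ν : ℕ, ν ≤ deltaSet k m γ Λ ∧ V = VLam k m γ Λ ν := by
  have hp := aux_prime k
  obtain ⟨hV0, hVi, hmax⟩ := hV
  obtain ⟨he1, c, hc⟩ := aux_exp_spec k m γ V
  obtain ⟨d, a, hda, hd⟩ := aux_factor k he1
  have hd1 : 1 ≤ d := Nat.pos_of_ne_zero (by rintro rfl; simp at hd)
  set Λ : Set (AlgebraicClosure k) :=
    {μ | μ ∈ specOf k m γ ∧ μ ^ (d * ringChar k ^ a) = c} with hΛ
  have hle : V ≤ VLam k m γ Λ a := aux_le_VLam k m γ hVi d a hd c (by rwa [← hda])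
  have hsc := aux_VLam_scalar k m γ (Λ := Λ) d a c (fun μ hμ => hμ.2)
  have hsub : Λ ⊆ specOf k m γ := fun μ hμ => hμ.1
  have hVeq : V = VLam k m γ Λ a := by
    by_contra hne
    have h1 := hmax (VLam k m γ Λ a) (fun h => hV0 (le_bot_iff.1 (h ▸ hle)))
      (aux_VLam_invt k m γ Λ a) (lt_of_le_of_ne hle hne)
    have h2 := aux_exp_le k m γ (by rwa [← hda]) c hsc
    omega
  have hne : Λ.Nonempty := by
    by_contra h
    rw [Set.not_nonempty_iff_eq_empty] at h
    apply hV0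
    rw [hVeq, h]
    simp [VLam]
  have hDle : DOf k Λ ≤ d := aux_D_le k hd1 fun μ hμ μ' hμ' =>
    aux_pow_inj k μ μ' d a (by rw [hμ.2, hμ'.2])
  refine ⟨Λ, ⟨hne, hsub, ?_⟩, a, ?_, hVeq⟩
  · intro Δ hΔ hlt
    by_contra! hD
    obtain ⟨δ, hδΔ, hδΛ⟩ := Set.exists_of_ssubset hlt
    have hlt' : V < VLam k m γ Δ a := by
      rw [hVeq]
      refine lt_of_le_of_ne (aux_VLam_mono k m γ hlt.1 a) fun heq => hδΛ ⟨hΔ hδΔ, ?_⟩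
      obtain ⟨v, hv0, hv⟩ := aux_spec_vec k m γ (hΔ hδΔ)
      have h1 := aux_eig_mem_VLam k m γ a hδΔ hv
      rw [← heq] at h1
      have h2 := hsc v h1
      rw [aux_eig_pow _ δ v hv] at h2
      exact smul_left_injective _ hv0 h2
    have h1 := hmax _ (ne_bot_of_gt hlt') (aux_VLam_invt k m γ Δ a) hlt'
    have h2 := aux_exp_VLam_le k m γ hΔ (hne.mono hlt.1) a
    have h3 : DOf k Δ * ringChar k ^ a ≤ d * ringChar k ^ a :=
      Nat.mul_le_mul_right _ (hD.trans hDle)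
    omega
  · by_contra! hlt
    set b := deltaSet k m γ Λ with hb
    have hle2 : V ≤ VLam k m γ Λ b := by
      rw [hVeq]
      refine iSup₂_le fun μ hμ v hv => ?_
      apply aux_ker_le_VLam k m γ b hμ
      refine aux_mult_le _ μ _ v hv _ ?_
      exact (aux_delta_spec k m γ μ).trans
        (Nat.pow_le_pow_right hp.out.pos (aux_delta_le_set k m γ hsub hμ))
    obtain ⟨μ₀, hμ₀⟩ := hne
    have hs2 := aux_VLam_scalar k m γ (Λ := Λ) d b (μ₀ ^ (d * ringChar k ^ b)) (fun μ hμ => by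
      rw [pow_mul, pow_mul, aux_pow_inj k μ μ₀ d a (by rw [hμ.2, hμ₀.2])])
    have h1 := aux_exp_le k m γ (V := V) (Nat.mul_pos hd1 (pow_pos hp.out.pos b)) _
      (fun v hv => hs2 v (hle2 hv))
    have h2 : d * ringChar k ^ b < d * ringChar k ^ a :=
      Nat.mul_lt_mul_of_pos_left (Nat.pow_lt_pow_right hp.out.one_lt hlt) hd1
    omega

lemma aux_backward {Λ : Set (AlgebraicClosure k)} (hΛ : DProper k m γ Λ) {ν : ℕ}
    (hν : ν ≤ deltaSet k m γ Λ) {W} (hW : IsInvt k m γ W) (hlt : VLam k m γ Λ ν < W) :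
    expV k m γ (VLam k m γ Λ ν) < expV k m γ W := by
  have hp := aux_prime k
  obtain ⟨hne, hsub, hD⟩ := hΛ
  by_contra! hle
  obtain ⟨he1, c, hc⟩ := aux_exp_spec k m γ W
  obtain ⟨d, a, hda, hd⟩ := aux_factor k he1
  rw [hda] at hc he1
  have hd1 : 1 ≤ d := Nat.pos_of_ne_zero (by rintro rfl; simp at hd)
  have hWle := aux_le_VLam k m γ hW d a hd c hc
  set Λ' : Set (AlgebraicClosure k) :=
    {μ | μ ∈ specOf k m γ ∧ μ ^ (d * ringChar k ^ a) = c} with hΛ'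
  have hsub' : Λ' ⊆ specOf k m γ := fun μ hμ => hμ.1
  have hΛΛ' : Λ ⊆ Λ' := by
    intro μ hμ
    refine ⟨hsub hμ, ?_⟩
    obtain ⟨v, hv0, hv⟩ := aux_spec_vec k m γ (hsub hμ)
    have h2 := hc v (hlt.le (aux_eig_mem_VLam k m γ ν hμ hv))
    rw [aux_eig_pow _ μ v hv] at h2
    exact smul_left_injective _ hv0 h2
  have hexp := aux_exp_VLam_le k m γ hsub hne ν
  have hDle : DOf k Λ' ≤ d := aux_D_le k hd1 fun μ hμ μ' hμ' =>
    aux_pow_inj k μ μ' d a (by rw [hμ.2, hμ'.2])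
  have hνa : ν ≤ a := by
    obtain ⟨μ, hμ, hμδ⟩ := aux_delta_attained k m γ hsub hne
    by_contra! hlt2
    have h1 : multOf k m γ μ ≤ ringChar k ^ a := by
      refine aux_mult_ge _ μ _ (ringChar k ^ ν) (Nat.pow_lt_pow_right hp.out.one_lt hlt2) ?_
      intro v hv
      have hμ0 : μ ≠ 0 := by
        rintro rfl
        obtain ⟨w, hw0, hw⟩ := aux_spec_vec k m γ (hsub hμ)
        rw [zero_smul] at hw
        exact hw0 (aux_inj k m γ (by rw [hw, map_zero]))
      refine aux_B _ (ringChar k) μ hμ0 d a hd v _ hv ?_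
      rw [(hΛΛ' hμ).2]
      exact hc v (hlt.le (aux_ker_le_VLam k m γ ν hμ hv))
    have := aux_delta_le k m γ h1
    omega
  have hpow : ringChar k ^ ν ≤ ringChar k ^ a := Nat.pow_le_pow_right hp.out.pos hνa
  have heq : Λ = Λ' := by
    by_contra hneq
    have h1 := hD Λ' hsub' (hΛΛ'.ssubset_of_ne hneq)
    have h2 : DOf k Λ * ringChar k ^ ν < d * ringChar k ^ ν :=
      Nat.mul_lt_mul_of_pos_right (h1.trans_le hDle) (pow_pos hp.out.pos ν)
    have h3 : d * ringChar k ^ ν ≤ d * ringChar k ^ a := Nat.mul_le_mul_left _ hpow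
    omega
  have haν : a ≤ ν := by
    by_contra! hlt2
    have h2 : d * ringChar k ^ ν < d * ringChar k ^ a :=
      Nat.mul_lt_mul_of_pos_left (Nat.pow_lt_pow_right hp.out.one_lt hlt2) hd1
    rw [← heq] at hDle
    have h3 : DOf k Λ * ringChar k ^ ν ≤ d * ringChar k ^ ν := Nat.mul_le_mul_right _ hDle
    omega
  rw [← heq, le_antisymm haν hνa] at hWle
  exact absurd hlt (not_lt_of_ge hWle)

end basics

/-- A nonzero `γ`-invariant subspace `V ⊆ k̄^{N+1}` is proper iff
`V = V_Λ^{(ν)}` for some `D`-proper `Λ ⊆ VP_γ` and some `0 ≤ ν ≤ δ(Λ)`. -/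
theorem stmt17 (k : Type*) [Field k] [Fintype k] (N : ℕ)
    (γ : Matrix.GeneralLinearGroup (Fin (N + 1)) k)
    (V : Submodule (AlgebraicClosure k) (Fin (N + 1) → AlgebraicClosure k))
    (hV0 : V ≠ ⊥) (hVi : IsInvt k (N + 1) γ V) :
    IsProper k (N + 1) γ V ↔
      ∃ Λ : Set (AlgebraicClosure k), DProper k (N + 1) γ Λ ∧
        ∃ ν : ℕ, ν ≤ deltaSet k (N + 1) γ Λ ∧ V = VLam k (N + 1) γ Λ ν := by
  constructor
  · exact aux_forward k (N + 1) γ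
  · rintro ⟨Λ, hΛ, ν, hν, rfl⟩
    exact ⟨hV0, hVi, fun W _ hW hlt => aux_backward k (N + 1) γ hΛ hν hW hlt⟩
end
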